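/- Let A_{-1}, A_0, A_1, G be as in the context, with G𝟙 ≤ 𝟙 entrywise, and let θ > 0 be a real number with θ𝟙 ≤ A_{-1}𝟙 entrywise. Then the operator W := I − A_0 − A_1G is invertible in B(ℓ∞), its inverse W^{-1} is positive, and ‖W^{-1}‖ ≤ 1/θ. -/

import Mathlib

open BoundedContinuousFunction Filter

noncomputable section

/-- ℓ∞: the Banach space of bounded real sequences with the sup norm. -/
abbrev Linf : Type := BoundedContinuousFunction ℕ ℝ

/-- A sequence is nonnegative if all its entries are nonnegative. -/
def vnonneg (x : Linf) : Prop := ∀ i, 0 ≤ x i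

/-- An operator in B(ℓ∞) is positive if it maps nonnegative sequences to
nonnegative sequences. -/
def OpPos (A : Linf →L[ℝ] Linf) : Prop := ∀ x : Linf, vnonneg x → vnonneg (A x)

/-- The constant sequence with all entries equal to one. -/
def ones : Linf := BoundedContinuousFunction.const ℕ (1 : ℝ)

theorem vnonneg_ones : vnonneg ones := fun _ => zero_le_one

theorem OpPos.apply_mono {A : Linf →L[ℝ] Linf} (hA : OpPos A) {x y : Linf}
    (h : ∀ i, x i ≤ y i) (i : ℕ) : (A x) i ≤ (A y) i := by
  have := hA (y - x) (fun j => by simpa using h j) i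
  simpa using this

theorem OpPos.add {A B : Linf →L[ℝ] Linf} (hA : OpPos A) (hB : OpPos B) : OpPos (A + B) :=
  fun x hx i => add_nonneg (hA x hx i) (hB x hx i)

theorem OpPos.mul {A B : Linf →L[ℝ] Linf} (hA : OpPos A) (hB : OpPos B) : OpPos (A * B) :=
  fun x hx => hA (B x) (hB x hx)

theorem OpPos.pow {A : Linf →L[ℝ] Linf} (hA : OpPos A) (n : ℕ) : OpPos (A ^ n) := by
  induction n with
  | zero => exact fun x hx => hx
  | succ n ih => rw [pow_succ]; exact ih.mul hA

/-- The norm of a positive operator is controlled by its value at the constant sequence. -/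
theorem OpPos.norm_le {A : Linf →L[ℝ] Linf} (hA : OpPos A) {c : ℝ} (hc : 0 ≤ c)
    (h : ∀ i, (A ones) i ≤ c) : ‖A‖ ≤ c := by
  refine A.opNorm_le_bound hc fun x => ?_
  refine (BoundedContinuousFunction.norm_le (by positivity)).2 fun i => ?_
  have hx : ∀ j, |x j| ≤ ‖x‖ := fun j => x.norm_coe_le_norm j
  have hup : (A x) i ≤ (A (‖x‖ • ones)) i :=
    hA.apply_mono (fun j => by simpa [ones] using (abs_le.1 (hx j)).2) i
  have hlow : (A ((-‖x‖) • ones)) i ≤ (A x) i :=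
    hA.apply_mono (fun j => by simpa [ones] using (abs_le.1 (hx j)).1) i
  have hm : ‖x‖ * (A ones) i ≤ ‖x‖ * c := mul_le_mul_of_nonneg_left (h i) (norm_nonneg x)
  rw [map_smul, BoundedContinuousFunction.coe_smul] at hup hlow
  simp only [smul_eq_mul] at hup hlow
  rw [Real.norm_eq_abs, abs_le]
  constructor <;> linarith

theorem OpPos.tsum {f : ℕ → Linf →L[ℝ] Linf} (hf : ∀ n, OpPos (f n)) (hs : Summable f) :
    OpPos (∑' n, f n) := by
  intro x hx i
  have h := (hs.hasSum.mapL (ContinuousLinearMap.apply ℝ Linf x)).mapL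
    (BoundedContinuousFunction.evalCLM ℝ i)
  exact h.nonneg fun n => hf n x hx i

/-- A perturbation of the identity by an element of norm at most `1 - θ` has its Neumann series
as an inverse, of norm at most `1 / θ`. -/
theorem neumann_series_inverse {R : Type*} [NormedRing R] [HasSummableGeomSeries R]
    (h1 : ‖(1 : R)‖ ≤ 1) {θ : ℝ} (hθ : 0 < θ) {K : R} (hK : ‖K‖ ≤ 1 - θ) :
    Summable (fun n => K ^ n) ∧ (1 - K) * ∑' n, K ^ n = 1 ∧ (∑' n, K ^ n) * (1 - K) = 1 ∧
      ‖∑' n, K ^ n‖ ≤ 1 / θ := by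
  have hlt : ‖K‖ < 1 := by linarith
  refine ⟨summable_geometric_of_norm_lt_one hlt, mul_neg_geom_series K hlt,
    geom_series_mul_neg K hlt, ?_⟩
  have h2 : (1 - ‖K‖)⁻¹ ≤ θ⁻¹ := inv_anti₀ hθ (by linarith)
  have h3 := tsum_geometric_le_of_norm_lt_one K hlt
  rw [one_div]
  linarith

/-- W = I - A₀ - A₁G is invertible in B(ℓ∞) with a positive inverse of norm
at most 1/θ, provided θ𝟙 ≤ A₋₁𝟙 and G𝟙 ≤ 𝟙. -/
theorem stmt8
    (Am1 A0 A1 G : Linf →L[ℝ] Linf)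
    (hAm1 : OpPos Am1) (hA0 : OpPos A0) (hA1 : OpPos A1) (hG : OpPos G)
    (hstoch : (Am1 + A0 + A1) ones = ones)
    (heq : A1 * G ^ 2 + A0 * G + Am1 = G)
    (hG1 : ∀ i, (G ones) i ≤ 1)
    (θ : ℝ) (hθpos : 0 < θ)
    (hθ : ∀ i, θ ≤ (Am1 ones) i) :
    ∃ Winv : Linf →L[ℝ] Linf,
      (1 - A0 - A1 * G) * Winv = 1 ∧ Winv * (1 - A0 - A1 * G) = 1 ∧
      OpPos Winv ∧ ‖Winv‖ ≤ 1 / θ := by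
  have hK : OpPos (A0 + A1 * G) := hA0.add (hA1.mul hG)
  have hK1 : ∀ i, ((A0 + A1 * G) ones) i ≤ 1 - θ := fun i => by
    have h1 : (A1 (G ones)) i ≤ (A1 ones) i := hA1.apply_mono hG1 i
    have h2 : (Am1 ones) i + (A0 ones) i + (A1 ones) i = 1 := congrArg (fun y : Linf => y i) hstoch
    have h3 := hθ i
    change (A0 ones) i + (A1 (G ones)) i ≤ 1 - θ
    linarith
  have hKnorm : ‖A0 + A1 * G‖ ≤ 1 - θ :=
    hK.norm_le ((hK ones vnonneg_ones 0).trans (hK1 0)) hK1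
  obtain ⟨hsum, hright, hleft, hnorm⟩ :=
    neumann_series_inverse (R := Linf →L[ℝ] Linf) ContinuousLinearMap.norm_id_le hθpos hKnorm
  have hW : 1 - A0 - A1 * G = 1 - (A0 + A1 * G) := sub_sub 1 A0 (A1 * G)
  rw [hW]
  exact ⟨∑' n, (A0 + A1 * G) ^ n, hright, hleft, OpPos.tsum hK.pow hsum, hnorm⟩
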